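/- Let ℋ be a q-ary Hamming code of length n_m = (q^m−1)/(q−1) (m ≥ 2), let ℓ ≥ 1, u ≥ 0, and let C = {(x_1|⋯|x_ℓ|y) ∈ 𝔽_q^{ℓn_m+u} : x_i ∈ 𝔽_q^{n_m}, x_1+⋯+x_ℓ ∈ ℋ, y ∈ 𝔽_q^u}. Then C is completely regular with covering radius 1 and its intersection numbers satisfy a_0 = (q−1)u, b_0 = (q−1)·ℓ·n_m, c_1 = ℓ, and a_1 = (ℓ·n_m + u)(q−1) − ℓ, where n = ℓn_m + u is the length of C and a_l = (q−1)n − b_l − c_l. -/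

import Mathlib

open Finset

variable {F : Type*} [Field F] [Fintype F] [DecidableEq F]

/-- The Hamming distance from a vector to a code. -/
noncomputable def distToCode {ι : Type*} [Fintype ι] (C : Set (ι → F)) (x : ι → F) : ℕ :=
  sInf {d : ℕ | ∃ c ∈ C, hammingDist x c = d}

/-- The covering radius of a code: the maximal distance of a vector to the code. -/
noncomputable def coveringRadius {ι : Type*} [Fintype ι] (C : Set (ι → F)) : ℕ :=
  sSup {d : ℕ | ∃ x : ι → F, distToCode C x = d}

/-- `C` has intersection numbers `b l` (number of neighbours one step further from the code)
and `c l` (number of neighbours one step closer to the code), for every `x` at distance `l`. -/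
def HasIntersectionNumbers {ι : Type*} [Fintype ι] (C : Set (ι → F)) (b c : ℕ → ℕ) : Prop :=
  ∀ l : ℕ, ∀ x : ι → F, distToCode C x = l →
    Nat.card {y : ι → F | hammingDist x y = 1 ∧ distToCode C y = l + 1} = b l ∧
    Nat.card {y : ι → F | hammingDist x y = 1 ∧ distToCode C y + 1 = l} = c l

/-- A code is completely regular if it admits intersection numbers. -/
def IsCompletelyRegular {ι : Type*} [Fintype ι] (C : Set (ι → F)) : Prop :=
  ∃ b c : ℕ → ℕ, HasIntersectionNumbers C b c

/-- The minimum distance of a code. -/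
noncomputable def minDist {ι : Type*} [Fintype ι] (C : Set (ι → F)) : ℕ :=
  sInf {d : ℕ | ∃ x ∈ C, ∃ y ∈ C, x ≠ y ∧ hammingDist x y = d}

/-- A code is equidistant if any two distinct codewords are at the same Hamming distance. -/
def IsEquidistant {ι : Type*} [Fintype ι] (C : Set (ι → F)) : Prop :=
  ∃ d : ℕ, ∀ x ∈ C, ∀ y ∈ C, x ≠ y → hammingDist x y = d

/-- The dual of a code, with respect to the standard bilinear form. -/
def dualSet {ι : Type*} [Fintype ι] (C : Set (ι → F)) : Set (ι → F) :=
  {y | ∀ x ∈ C, ∑ i, x i * y i = 0}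

/-- A code of length `n` is antipodal if it contains a word of Hamming weight `n`. -/
def IsAntipodal {ι : Type*} [Fintype ι] (C : Set (ι → F)) : Prop :=
  ∃ v ∈ C, hammingNorm v = Fintype.card ι

/-- A monomial transformation: a coordinate permutation composed with multiplication of
each coordinate by a nonzero scalar. -/
def IsMonomialMap {ι : Type*} (φ : (ι → F) → (ι → F)) : Prop :=
  ∃ (π : Equiv.Perm ι) (s : ι → Fˣ), ∀ x i, φ x i = (s i : F) * x (π i)

/-- Two codes are monomially equivalent if one is the image of the other under a bijection of
coordinates together with multiplication of each coordinate by a nonzero scalar. -/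
def MonomiallyEquivalent {ι κ : Type*} (C : Set (ι → F)) (D : Set (κ → F)) : Prop :=
  ∃ (e : ι ≃ κ) (s : ι → Fˣ),
    (fun (x : ι → F) (j : κ) => (s (e.symm j) : F) * x (e.symm j)) '' C = D

/-- The orbit, under the action of `Aut C` on the cosets of `C`, of the coset of `v`
(realised as the union of all cosets in the orbit). -/
def cosetOrbit {ι : Type*} (C : Submodule F (ι → F)) (v : ι → F) : Set (ι → F) :=
  {w | ∃ φ : (ι → F) → (ι → F), IsMonomialMap φ ∧
    φ '' (C : Set (ι → F)) = (C : Set (ι → F)) ∧ φ v - w ∈ C}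

/-- The number of orbits of the action of `Aut C` on the cosets of `C`. -/
noncomputable def numCosetOrbits {ι : Type*} (C : Submodule F (ι → F)) : ℕ :=
  Nat.card (Set.range (cosetOrbit C))

/-- `H` is a `q`-ary Hamming code with parameter `m ≥ 2`: a perfect
`[(q^m-1)/(q-1), (q^m-1)/(q-1) - m, 3]_q` code with covering radius 1. -/
def IsHammingCode (m : ℕ) {nm : ℕ} (H : Submodule F (Fin nm → F)) : Prop :=
  2 ≤ m ∧ nm = (Fintype.card F ^ m - 1) / (Fintype.card F - 1) ∧
  Module.finrank F H = nm - m ∧ minDist (H : Set (Fin nm → F)) = 3 ∧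
  coveringRadius (H : Set (Fin nm → F)) = 1

/-- The extended code: append an overall parity-check coordinate. -/
def extendedCode {m : ℕ} (D : Set (Fin m → F)) : Set (Fin (m + 1) → F) :=
  {z | (fun i : Fin m => z i.castSucc) ∈ D ∧ ∑ i, z i = 0}

/-- Construction I(u): append `u` free coordinates to every codeword. -/
def appendCode (u : ℕ) {n : ℕ} (C : Set (Fin n → F)) : Set (Fin (n + u) → F) :=
  {z | ∃ c ∈ C, ∃ y : Fin u → F, z = Fin.append c y}

/-- Construction II(ℓ): codewords are `ℓ`-tuples of blocks whose `λ`-weighted sum lies in `C`. -/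
def repeatCode {n ℓ : ℕ} (lam : Fin ℓ → Fˣ) (C : Set (Fin n → F)) :
    Set (Fin ℓ × Fin n → F) :=
  {z | (fun j : Fin n => ∑ i : Fin ℓ, (lam i : F) * z (i, j)) ∈ C}

/-- The code `{(x₁|⋯|x_ℓ|y) : x₁+⋯+x_ℓ ∈ H, y free}` built from a code `H`. -/
def hammingRepeatCode {nm : ℕ} (ℓ u : ℕ) (H : Set (Fin nm → F)) :
    Set ((Fin ℓ × Fin nm) ⊕ Fin u → F) :=
  {z | (fun j : Fin nm => ∑ i : Fin ℓ, z (Sum.inl (i, j))) ∈ H}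

section Helpers

variable {K ι : Type*}

theorem hammingDist_add_single [Field K] [DecidableEq K] [Fintype ι] [DecidableEq ι]
    (x : ι → K) (i : ι) {a : K} (ha : a ≠ 0) :
    hammingDist x (x + Pi.single i a) = 1 := by
  have : ({j | x j ≠ (x + Pi.single i a : ι → K) j} : Finset ι) = {i} := by
    ext j
    by_cases h : j = i
    · subst h; simp [ha]
    · simp [h]
  rw [hammingDist, this, Finset.card_singleton]

theorem hammingDist_eq_one_iff [Field K] [DecidableEq K] [Fintype ι] [DecidableEq ι]
    {x y : ι → K} :
    hammingDist x y = 1 ↔ ∃ i a, a ≠ 0 ∧ y = x + Pi.single i a := by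
  constructor
  · intro h
    rw [hammingDist, Finset.card_eq_one] at h
    obtain ⟨i, hi⟩ := h
    have key : ∀ j, x j ≠ y j ↔ j = i := fun j => by
      simpa using Finset.ext_iff.1 hi j
    refine ⟨i, y i - x i, sub_ne_zero.2 (((key i).2 rfl).symm), ?_⟩
    ext j
    by_cases h : j = i
    · subst h; simp
    · have := mt (key j).1 h
      push Not at this
      simp [h, this]
  · rintro ⟨i, a, ha, rfl⟩
    exact hammingDist_add_single x i ha

theorem single_eq_single [Field K] [DecidableEq ι] {i j : ι} {a b : K} (ha : a ≠ 0)
    (h : (Pi.single i a : ι → K) = Pi.single j b) : i = j ∧ a = b := by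
  have hij : i = j := by
    by_contra hij
    have := congrFun h i
    simp [hij, ha] at this
  subst hij
  exact ⟨rfl, Pi.single_injective i h⟩

theorem distToCode_le [DecidableEq K] [Fintype ι] {C : Set (ι → K)} {x c : ι → K} (hc : c ∈ C) :
    distToCode C x ≤ hammingDist x c :=
  Nat.sInf_le ⟨c, hc, rfl⟩

theorem exists_hammingDist_eq_distToCode [DecidableEq K] [Fintype ι]
    {C : Set (ι → K)} (hC : C.Nonempty) (x : ι → K) :
    ∃ c ∈ C, hammingDist x c = distToCode C x :=
  have ⟨c, hc⟩ := hC
  Nat.sInf_mem (s := {d : ℕ | ∃ c ∈ C, hammingDist x c = d}) ⟨_, c, hc, rfl⟩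

theorem distToCode_eq_zero_iff [DecidableEq K] [Fintype ι]
    {C : Set (ι → K)} (hC : C.Nonempty) {x : ι → K} :
    distToCode C x = 0 ↔ x ∈ C := by
  constructor
  · intro h
    obtain ⟨c, hc, hd⟩ := exists_hammingDist_eq_distToCode hC x
    rw [h, hammingDist_eq_zero] at hd
    rwa [hd]
  · intro h
    simpa using distToCode_le (x := x) h

theorem distToCode_le_coveringRadius [Fintype K] [DecidableEq K] [Fintype ι]
    (C : Set (ι → K)) (x : ι → K) :
    distToCode C x ≤ coveringRadius C :=
  le_csSup (Set.finite_range (distToCode C)).bddAbove ⟨x, rfl⟩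

theorem coveringRadius_eq_one [Fintype K] [DecidableEq K] [Fintype ι]
    {C : Set (ι → K)} (hle : ∀ x, distToCode C x ≤ 1)
    (hex : ∃ x, distToCode C x = 1) : coveringRadius C = 1 := by
  obtain ⟨x, hx⟩ := hex
  refine le_antisymm (csSup_le ⟨1, x, hx⟩ ?_) (hx ▸ distToCode_le_coveringRadius C x)
  rintro _ ⟨y, rfl⟩
  exact hle y

theorem exists_notMem_of_coveringRadius_eq_one [Field K] [DecidableEq K] [Fintype ι]
    {C : Set (ι → K)} (h : coveringRadius C = 1) :
    ∃ x, x ∉ C := by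
  by_contra! hall
  have hC : C.Nonempty := ⟨0, hall 0⟩
  have h0 : coveringRadius C ≤ 0 := by
    refine csSup_le ⟨_, 0, rfl⟩ ?_
    rintro _ ⟨y, rfl⟩
    exact ((distToCode_eq_zero_iff hC).2 (hall y)).le
  omega

theorem exists_add_single_mem [Field K] [Fintype K] [DecidableEq K] [Fintype ι] [DecidableEq ι]
    {C : Set (ι → K)} (hC : C.Nonempty)
    (h : coveringRadius C = 1) {x : ι → K} (hx : x ∉ C) :
    ∃ i a, a ≠ 0 ∧ x + Pi.single i a ∈ C := by
  have h1 : distToCode C x = 1 := by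
    have := distToCode_le_coveringRadius C x
    have := mt (distToCode_eq_zero_iff hC).1 hx
    omega
  obtain ⟨c, hc, hd⟩ := exists_hammingDist_eq_distToCode hC x
  rw [h1, hammingDist_eq_one_iff] at hd
  obtain ⟨i, a, ha, rfl⟩ := hd
  exact ⟨i, a, ha, hc⟩

theorem eq_of_hammingDist_lt_minDist [DecidableEq K] [Fintype ι]
    {C : Set (ι → K)} {x y : ι → K} (hx : x ∈ C) (hy : y ∈ C)
    (h : hammingDist x y < minDist C) : x = y := by
  by_contra hne
  exact h.not_ge (Nat.sInf_le ⟨x, hx, y, hy, hne, rfl⟩)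

theorem add_single_mem_unique [Field K] [DecidableEq K] [Fintype ι] [DecidableEq ι]
    {C : Set (ι → K)} (h : 3 ≤ minDist C) {x : ι → K}
    {i j : ι} {a b : K} (ha : a ≠ 0) (hb : b ≠ 0) (hi : x + Pi.single i a ∈ C)
    (hj : x + Pi.single j b ∈ C) : i = j ∧ a = b := by
  refine single_eq_single ha (add_left_cancel (eq_of_hammingDist_lt_minDist hi hj ?_))
  have := hammingDist_triangle_right (x + Pi.single i a) (x + Pi.single j b) x
  rw [hammingDist_comm _ x, hammingDist_comm _ x, hammingDist_add_single x i ha,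
    hammingDist_add_single x j hb] at this
  omega

theorem add_single_notMem [Field K] [DecidableEq K] [Fintype ι] [DecidableEq ι]
    {C : Set (ι → K)} (h : 3 ≤ minDist C) {x : ι → K}
    (hx : x ∈ C) (i : ι) {a : K} (ha : a ≠ 0) : x + Pi.single i a ∉ C := fun hi => by
  have hd := hammingDist_add_single x i ha
  have := eq_of_hammingDist_lt_minDist hx hi (by omega)
  rw [← this, hammingDist_self] at hd
  omega

end Helpers

section HammingRepeatCode

variable {K : Type*} [Field K] {nm ℓ u : ℕ}

/-- The sum of the `ℓ` blocks of a vector. -/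
def blockSum (z : (Fin ℓ × Fin nm) ⊕ Fin u → K) : Fin nm → K :=
  fun j => ∑ i, z (Sum.inl (i, j))

theorem mem_hammingRepeatCode {H : Set (Fin nm → K)} {z : (Fin ℓ × Fin nm) ⊕ Fin u → K} :
    z ∈ hammingRepeatCode ℓ u H ↔ blockSum z ∈ H := Iff.rfl

theorem blockSum_add_single_inl (z : (Fin ℓ × Fin nm) ⊕ Fin u → K) (i : Fin ℓ) (j : Fin nm)
    (a : K) : blockSum (z + Pi.single (Sum.inl (i, j)) a) = blockSum z + Pi.single j a := by
  ext k
  simp only [blockSum, Pi.add_apply, Finset.sum_add_distrib]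
  congr 1
  by_cases h : k = j
  · subst h
    simp [Pi.single_apply]
  · simp [h]

theorem blockSum_add_single_inr (z : (Fin ℓ × Fin nm) ⊕ Fin u → K) (k : Fin u) (a : K) :
    blockSum (z + Pi.single (Sum.inr k) a) = blockSum z := by
  ext j
  simp [blockSum]

theorem exists_blockSum_eq (hℓ : 1 ≤ ℓ) (v : Fin nm → K) :
    ∃ z : (Fin ℓ × Fin nm) ⊕ Fin u → K, blockSum z = v := by
  refine ⟨Sum.elim (fun p => if p.1 = ⟨0, hℓ⟩ then v p.2 else 0) 0, ?_⟩
  ext j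
  simp [blockSum]

variable {H : Set (Fin nm → K)}

theorem hammingRepeatCode_nonempty (hℓ : 1 ≤ ℓ) (hH : H.Nonempty) :
    (hammingRepeatCode ℓ u H).Nonempty := by
  obtain ⟨v, hv⟩ := hH
  obtain ⟨z, rfl⟩ := exists_blockSum_eq (u := u) hℓ v
  exact ⟨z, hv⟩

theorem distToCode_hammingRepeatCode_le_one [Fintype K] [DecidableEq K]
    (hℓ : 1 ≤ ℓ) (hne : H.Nonempty) (hr : coveringRadius H = 1) (z : (Fin ℓ × Fin nm) ⊕ Fin u → K) :
    distToCode (hammingRepeatCode ℓ u H) z ≤ 1 := by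
  by_cases hz : blockSum z ∈ H
  · rw [(distToCode_eq_zero_iff (hammingRepeatCode_nonempty hℓ hne)).2 hz]
    exact zero_le_one
  · obtain ⟨j, a, ha, hj⟩ := exists_add_single_mem hne hr hz
    rw [← hammingDist_add_single z (Sum.inl (⟨0, hℓ⟩, j)) ha]
    apply distToCode_le
    rwa [mem_hammingRepeatCode, blockSum_add_single_inl]

theorem distToCode_hammingRepeatCode_eq_one_iff [Fintype K] [DecidableEq K]
    (hℓ : 1 ≤ ℓ) (hne : H.Nonempty) (hr : coveringRadius H = 1) {z : (Fin ℓ × Fin nm) ⊕ Fin u → K} :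
    distToCode (hammingRepeatCode ℓ u H) z = 1 ↔ blockSum z ∉ H := by
  have h0 := distToCode_eq_zero_iff (hammingRepeatCode_nonempty (u := u) hℓ hne) (x := z)
  have h1 := distToCode_hammingRepeatCode_le_one hℓ hne hr z
  rw [← mem_hammingRepeatCode, ← h0]
  omega

theorem card_neighbors_notMem [Fintype K] [DecidableEq K]
    (hd : 3 ≤ minDist H) {z : (Fin ℓ × Fin nm) ⊕ Fin u → K}
    (hz : blockSum z ∈ H) :
    Nat.card {y | hammingDist z y = 1 ∧ blockSum y ∉ H} = (Fintype.card K - 1) * (ℓ * nm) := by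
  let f : Kˣ × (Fin ℓ × Fin nm) → ((Fin ℓ × Fin nm) ⊕ Fin u → K) :=
    fun p => z + Pi.single (Sum.inl p.2) (p.1 : K)
  have hf : Function.Injective f := by
    rintro ⟨a, p⟩ ⟨b, p'⟩ h
    obtain ⟨h1, h2⟩ := single_eq_single a.ne_zero (add_left_cancel h)
    exact Prod.ext (Units.ext h2) (Sum.inl_injective h1)
  have hrange : {y | hammingDist z y = 1 ∧ blockSum y ∉ H} = Set.range f := by
    ext y
    constructor
    · rintro ⟨hy, hyH⟩
      obtain ⟨⟨i, j⟩ | k, a, ha, rfl⟩ := hammingDist_eq_one_iff.1 hy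
      · exact ⟨(Units.mk0 a ha, (i, j)), rfl⟩
      · rw [blockSum_add_single_inr] at hyH
        exact absurd hz hyH
    · rintro ⟨⟨a, i, j⟩, rfl⟩
      refine ⟨hammingDist_add_single _ _ a.ne_zero, ?_⟩
      rw [blockSum_add_single_inl]
      exact add_single_notMem hd hz j a.ne_zero
  rw [hrange, Nat.card_range_of_injective hf]
  simp [Nat.card_eq_fintype_card, Fintype.card_units]

theorem card_neighbors_mem [Fintype K] [DecidableEq K] (hd : 3 ≤ minDist H) (hne : H.Nonempty)
    (hr : coveringRadius H = 1) {z : (Fin ℓ × Fin nm) ⊕ Fin u → K} (hz : blockSum z ∉ H) :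
    Nat.card {y | hammingDist z y = 1 ∧ blockSum y ∈ H} = ℓ := by
  obtain ⟨j, a, ha, hj⟩ := exists_add_single_mem hne hr hz
  let f : Fin ℓ → ((Fin ℓ × Fin nm) ⊕ Fin u → K) := fun i => z + Pi.single (Sum.inl (i, j)) a
  have hf : Function.Injective f := fun i i' h =>
    congrArg Prod.fst (Sum.inl_injective (single_eq_single ha (add_left_cancel h)).1)
  have hrange : {y | hammingDist z y = 1 ∧ blockSum y ∈ H} = Set.range f := by
    ext y
    constructor
    · rintro ⟨hy, hyH⟩
      obtain ⟨⟨i, j'⟩ | k, b, hb, rfl⟩ := hammingDist_eq_one_iff.1 hy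
      · rw [blockSum_add_single_inl] at hyH
        obtain ⟨rfl, rfl⟩ := add_single_mem_unique hd ha hb hj hyH
        exact ⟨i, rfl⟩
      · rw [blockSum_add_single_inr] at hyH
        exact absurd hyH hz
    · rintro ⟨i, rfl⟩
      refine ⟨hammingDist_add_single _ _ ha, ?_⟩
      rwa [blockSum_add_single_inl]
  rw [hrange, Nat.card_range_of_injective hf, Nat.card_fin]

theorem hasIntersectionNumbers_hammingRepeatCode [Fintype K] [DecidableEq K]
    (hℓ : 1 ≤ ℓ) (hne : H.Nonempty) (hd : 3 ≤ minDist H) (hr : coveringRadius H = 1) :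
    HasIntersectionNumbers (hammingRepeatCode ℓ u H)
      (fun l => if l = 0 then (Fintype.card K - 1) * (ℓ * nm) else 0)
      (fun l => if l = 1 then ℓ else 0) := by
  intro l z hz
  have hle := distToCode_hammingRepeatCode_le_one (u := u) hℓ hne hr
  have h1 := fun y => distToCode_hammingRepeatCode_eq_one_iff (u := u) hℓ hne hr (z := y)
  have h0 := fun y => (distToCode_eq_zero_iff
    (hammingRepeatCode_nonempty (u := u) hℓ hne) (x := y)).trans mem_hammingRepeatCode
  have hl : l = 0 ∨ l = 1 := by have := hle z; omega
  obtain rfl | rfl := hl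
  · refine ⟨?_, by simp⟩
    simpa [h1] using card_neighbors_notMem hd ((h0 z).1 hz)
  · constructor
    · have h2 : ∀ y, distToCode (hammingRepeatCode ℓ u H) y ≠ 2 := fun y => by
        have := hle y; omega
      simp [h2]
    · simpa [h0] using card_neighbors_mem hd hne hr ((h1 z).1 hz)

end HammingRepeatCode

/-- the code `{(x₁|⋯|x_ℓ|y) : x₁+⋯+x_ℓ ∈ ℋ, y free}` built from a Hamming code
is completely regular with covering radius 1, and has intersection numbers
`a₀ = (q-1)u`, `b₀ = (q-1)ℓn_m`, `c₁ = ℓ`, `a₁ = (ℓn_m+u)(q-1) - ℓ`. -/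
theorem hamming_repeat_code_completely_regular
    {F : Type*} [Field F] [Fintype F] [DecidableEq F] {m nm ℓ u : ℕ} (hℓ : 1 ≤ ℓ)
    (H : Submodule F (Fin nm → F)) (hH : IsHammingCode m H) :
    IsCompletelyRegular (hammingRepeatCode ℓ u (H : Set (Fin nm → F))) ∧
    coveringRadius (hammingRepeatCode ℓ u (H : Set (Fin nm → F))) = 1 ∧
    ∀ b c : ℕ → ℕ,
      HasIntersectionNumbers (hammingRepeatCode ℓ u (H : Set (Fin nm → F))) b c →
      (Fintype.card F - 1) * (ℓ * nm + u) - b 0 - c 0 = (Fintype.card F - 1) * u ∧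
      b 0 = (Fintype.card F - 1) * (ℓ * nm) ∧
      c 1 = ℓ ∧
      (Fintype.card F - 1) * (ℓ * nm + u) - b 1 - c 1 =
        (ℓ * nm + u) * (Fintype.card F - 1) - ℓ := by
  obtain ⟨-, -, -, hd, hr⟩ := hH
  have hne : (H : Set (Fin nm → F)).Nonempty := ⟨0, H.zero_mem⟩
  have hI := hasIntersectionNumbers_hammingRepeatCode (u := u) hℓ hne hd.ge hr
  obtain ⟨v, hv⟩ := exists_notMem_of_coveringRadius_eq_one hr
  obtain ⟨z₁, rfl⟩ := exists_blockSum_eq (u := u) hℓ v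
  have hz₁ := (distToCode_hammingRepeatCode_eq_one_iff hℓ hne hr).2 hv
  obtain ⟨z₀, hz₀⟩ := hammingRepeatCode_nonempty (u := u) hℓ hne
  replace hz₀ := (distToCode_eq_zero_iff ⟨z₀, hz₀⟩).2 hz₀
  refine ⟨⟨_, _, hI⟩, coveringRadius_eq_one
    (distToCode_hammingRepeatCode_le_one hℓ hne hr) ⟨z₁, hz₁⟩, fun b c hbc => ?_⟩
  have hb₀ : b 0 = (Fintype.card F - 1) * (ℓ * nm) :=
    (hbc 0 z₀ hz₀).1.symm.trans (hI 0 z₀ hz₀).1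
  have hc₀ : c 0 = 0 := (hbc 0 z₀ hz₀).2.symm.trans (hI 0 z₀ hz₀).2
  have hb₁ : b 1 = 0 := (hbc 1 z₁ hz₁).1.symm.trans (hI 1 z₁ hz₁).1
  have hc₁ : c 1 = ℓ := (hbc 1 z₁ hz₁).2.symm.trans (hI 1 z₁ hz₁).2
  refine ⟨?_, hb₀, hc₁, ?_⟩
  · rw [hb₀, hc₀, mul_add, Nat.add_sub_cancel_left, Nat.sub_zero]
  · rw [hb₁, hc₁, Nat.sub_zero, mul_comm]
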